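/- arXiv:2007.00553 — 2 statements merged into one kernel-verified Lean document; each statement's English description precedes it below -/
import Mathlib

section
/- For all sufficiently large k, the element ε_k = (6 + √5)^k + √5·α_k² − β_k² of ℤ[√5] is totally positive; that is, both ε_k > 0 (as a real number, with √5 the positive square root of 5) and σ(ε_k) > 0, where σ(ε_k) denotes the image of ε_k under the conjugation of ℤ[√5] sending √5 to −√5. -/
open Filter

/-- `x_k = √((6 − √5)^k / √5)`. -/
noncomputable def xSeq (k : ℕ) : ℝ := Real.sqrt (((6 : ℝ) - Real.sqrt 5) ^ k / Real.sqrt 5)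

/-- `α_k = ⌈x_k⌉ + √5`. -/
noncomputable def alphaSeq (k : ℕ) : ℝ := (⌈xSeq k⌉ : ℝ) + Real.sqrt 5

/-- The conjugate `σ(α_k) = ⌈x_k⌉ − √5` of `α_k` under `√5 ↦ −√5`. -/
noncomputable def alphaConjSeq (k : ℕ) : ℝ := (⌈xSeq k⌉ : ℝ) - Real.sqrt 5

/-- `y_k = ⌊√(u_k / 10)⌋`, as a real number. -/
noncomputable def ySeq (u : ℕ → ℤ) (k : ℕ) : ℝ := (⌊Real.sqrt ((u k : ℝ) / 10)⌋ : ℝ)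

/-- `β_k = ⌊√5 · y_k⌋ + √5 · y_k`. -/
noncomputable def betaSeq (u : ℕ → ℤ) (k : ℕ) : ℝ :=
  (⌊Real.sqrt 5 * ySeq u k⌋ : ℝ) + Real.sqrt 5 * ySeq u k

/-- The conjugate `σ(β_k) = ⌊√5 · y_k⌋ − √5 · y_k` of `β_k` under `√5 ↦ −√5`. -/
noncomputable def betaConjSeq (u : ℕ → ℤ) (k : ℕ) : ℝ :=
  (⌊Real.sqrt 5 * ySeq u k⌋ : ℝ) - Real.sqrt 5 * ySeq u k

/-- The integer and `√5` coordinates of `(6 + √5) ^ k` also give the conjugate power. -/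
lemma exists_pow_eq_and_conj_pow_eq (k : ℕ) : ∃ a b : ℤ,
    ((6 : ℝ) + Real.sqrt 5) ^ k = a + b * Real.sqrt 5 ∧
      ((6 : ℝ) - Real.sqrt 5) ^ k = a - b * Real.sqrt 5 := by
  have h5 : Real.sqrt 5 ^ 2 = 5 := Real.sq_sqrt (by norm_num)
  induction k with
  | zero => exact ⟨1, 0, by simp, by simp⟩
  | succ k ih =>
    obtain ⟨a, b, h1, h2⟩ := ih
    refine ⟨6 * a + 5 * b, a + 6 * b, ?_, ?_⟩
    · rw [pow_succ, h1]; push_cast; linear_combination (b : ℝ) * h5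
    · rw [pow_succ, h2]; push_cast; linear_combination (b : ℝ) * h5

/-- Coordinates with respect to `1, √5` are unique. -/
lemma eq_of_add_mul_sqrt_five_eq {a b c d : ℤ}
    (h : (a : ℝ) + b * Real.sqrt 5 = c + d * Real.sqrt 5) : a = c := by
  have hirr : Irrational (Real.sqrt 5) := by
    simpa using Nat.Prime.irrational_sqrt (p := 5) (by norm_num)
  have hbd : b = d := by
    by_contra hne
    refine (hirr.intCast_mul (sub_ne_zero.mpr hne)).ne_int (c - a) ?_
    push_cast
    linear_combination h
  subst hbd
  exact_mod_cast add_right_cancel h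

/-- The trace identity `2 u_k = (6 + √5) ^ k + (6 - √5) ^ k`. -/
lemma two_mul_eq_pow_add_conj_pow {k : ℕ} {m n : ℤ}
    (h : ((6 : ℝ) + Real.sqrt 5) ^ k = m + n * Real.sqrt 5) :
    2 * (m : ℝ) = ((6 : ℝ) + Real.sqrt 5) ^ k + ((6 : ℝ) - Real.sqrt 5) ^ k := by
  obtain ⟨a, b, h1, h2⟩ := exists_pow_eq_and_conj_pow_eq k
  rw [eq_of_add_mul_sqrt_five_eq (h.symm.trans h1), h1, h2]
  ring

lemma betaSeq_sq_le {u : ℕ → ℤ} {k : ℕ} (hu : (0 : ℝ) ≤ u k) :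
    betaSeq u k ^ 2 ≤ 2 * u k := by
  have h5 : Real.sqrt 5 ^ 2 = 5 := Real.sq_sqrt (by norm_num)
  have hw : Real.sqrt ((u k : ℝ) / 10) ^ 2 = u k / 10 := Real.sq_sqrt (by positivity)
  have hy0 : 0 ≤ ySeq u k := by
    unfold ySeq; exact_mod_cast Int.floor_nonneg.mpr (Real.sqrt_nonneg _)
  have hy : ySeq u k ^ 2 ≤ u k / 10 := by
    rw [← hw]; exact pow_le_pow_left₀ hy0 (Int.floor_le _) 2
  have hsy : 0 ≤ Real.sqrt 5 * ySeq u k := by positivity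
  have hfl : (0 : ℝ) ≤ ⌊Real.sqrt 5 * ySeq u k⌋ := by exact_mod_cast Int.floor_nonneg.mpr hsy
  calc betaSeq u k ^ 2 ≤ (2 * (Real.sqrt 5 * ySeq u k)) ^ 2 := by
        refine pow_le_pow_left₀ (add_nonneg hfl hsy) ?_ 2
        linarith [Int.floor_le (Real.sqrt 5 * ySeq u k)]
    _ = 20 * ySeq u k ^ 2 := by linear_combination 4 * ySeq u k ^ 2 * h5
    _ ≤ 2 * u k := by linarith

lemma betaConjSeq_sq_le_one (u : ℕ → ℤ) (k : ℕ) : betaConjSeq u k ^ 2 ≤ 1 := by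
  rw [sq_le_one_iff_abs_le_one, abs_le]
  unfold betaConjSeq
  constructor <;>
    linarith [Int.floor_le (Real.sqrt 5 * ySeq u k), Int.lt_floor_add_one (Real.sqrt 5 * ySeq u k)]

/-- For all large `k`, the element `ε_k = (6 + √5)^k + √5·α_k² − β_k²` of `ℤ[√5]`
is totally positive: both `ε_k > 0` and its conjugate
`σ(ε_k) = (6 − √5)^k − √5·σ(α_k)² − σ(β_k)²` is positive. -/
theorem epsilon_totally_positive (u v : ℕ → ℤ)
    (huv : ∀ k, ((6 : ℝ) + Real.sqrt 5) ^ k = (u k : ℝ) + (v k : ℝ) * Real.sqrt 5) :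
    ∀ᶠ k in atTop,
      0 < ((6 : ℝ) + Real.sqrt 5) ^ k + Real.sqrt 5 * alphaSeq k ^ 2 - betaSeq u k ^ 2 ∧
      0 < ((6 : ℝ) - Real.sqrt 5) ^ k - Real.sqrt 5 * alphaConjSeq k ^ 2
            - betaConjSeq u k ^ 2 := by
  have h5 : Real.sqrt 5 ^ 2 = 5 := Real.sq_sqrt (by norm_num)
  have hs2 : 2 < Real.sqrt 5 := Real.lt_sqrt_of_sq_lt (by norm_num)
  have hs3 : Real.sqrt 5 < 3 := (Real.sqrt_lt' (by norm_num)).mpr (by norm_num)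
  filter_upwards [eventually_ge_atTop 3] with k hk
  have htr := two_mul_eq_pow_add_conj_pow (huv k)
  have hR : 0 < ((6 : ℝ) + Real.sqrt 5) ^ k := by positivity
  have hR' : (27 : ℝ) ≤ ((6 : ℝ) - Real.sqrt 5) ^ k :=
    calc (27 : ℝ) = 3 ^ 3 := by norm_num
      _ ≤ 3 ^ k := pow_le_pow_right₀ (by norm_num) hk
      _ ≤ _ := pow_le_pow_left₀ (by norm_num) (by linarith) k
  have hx : Real.sqrt 5 * xSeq k ^ 2 = ((6 : ℝ) - Real.sqrt 5) ^ k := by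
    unfold xSeq
    rw [Real.sq_sqrt (by positivity)]
    field_simp
  have hx0 : 0 ≤ xSeq k := Real.sqrt_nonneg _
  have hx3 : 3 ≤ xSeq k := by
    by_contra! hlt
    nlinarith
  have hc1 : xSeq k ≤ ⌈xSeq k⌉ := Int.le_ceil _
  have hc2 : (⌈xSeq k⌉ : ℝ) < xSeq k + 1 := Int.ceil_lt_add_one _
  constructor
  · have hb := betaSeq_sq_le (u := u) (k := k) (by linarith)
    have ha : xSeq k ^ 2 < alphaSeq k ^ 2 :=
      pow_lt_pow_left₀ (by unfold alphaSeq; linarith) hx0 two_ne_zero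
    have hsa := mul_lt_mul_of_pos_left ha (by linarith : 0 < Real.sqrt 5)
    linarith
  · have hb := betaConjSeq_sq_le_one u k
    have ha : alphaConjSeq k ^ 2 ≤ (xSeq k - 1) ^ 2 :=
      pow_le_pow_left₀ (by unfold alphaConjSeq; linarith) (by unfold alphaConjSeq; linarith) 2
    have hgap : alphaConjSeq k ^ 2 + 5 ≤ xSeq k ^ 2 := by nlinarith
    have hsa := mul_le_mul_of_nonneg_left hgap (Real.sqrt_nonneg 5)
    linarith
end

section
/- For all sufficiently large k, one has β_k² > (6 + √5)^k as real numbers. -/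
open Filter

theorem int_add_int_mul_sqrt_five_inj {a b c d : ℤ}
    (h : (a : ℝ) + b * Real.sqrt 5 = c + d * Real.sqrt 5) : a = c ∧ b = d := by
  have hirr : Irrational (Real.sqrt 5) := by
    simpa using Nat.Prime.irrational_sqrt (p := 5) (by norm_num)
  have hbd : b = d := by
    by_contra hne
    have hne' : ((b - d : ℤ) : ℝ) ≠ 0 := by exact_mod_cast sub_ne_zero.mpr hne
    apply hirr
    refine ⟨((c - a : ℤ) : ℚ) / ((b - d : ℤ) : ℚ), ?_⟩
    push_cast at hne' ⊢
    rw [div_eq_iff hne']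
    linarith
  subst hbd
  refine ⟨?_, rfl⟩
  have : (a : ℝ) = c := by linarith
  exact_mod_cast this

theorem six_sub_sqrt_five_pow {u v : ℕ → ℤ}
    (huv : ∀ k, ((6 : ℝ) + Real.sqrt 5) ^ k = (u k : ℝ) + (v k : ℝ) * Real.sqrt 5) (k : ℕ) :
    ((6 : ℝ) - Real.sqrt 5) ^ k = (u k : ℝ) - (v k : ℝ) * Real.sqrt 5 := by
  have h5 : Real.sqrt 5 * Real.sqrt 5 = 5 := Real.mul_self_sqrt (by norm_num)
  induction k with
  | zero =>
    obtain ⟨hu, hv⟩ := int_add_int_mul_sqrt_five_inj (a := u 0) (b := v 0) (c := 1) (d := 0)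
      (by rw [← huv 0]; simp)
    simp [hu, hv]
  | succ k ih =>
    obtain ⟨hu, hv⟩ := int_add_int_mul_sqrt_five_inj (a := u (k + 1)) (b := v (k + 1))
      (c := 6 * u k + 5 * v k) (d := u k + 6 * v k)
      (by
        rw [← huv (k + 1), pow_succ, huv k]
        push_cast
        linear_combination (v k : ℝ) * h5)
    rw [pow_succ, ih, hu, hv]
    push_cast
    linear_combination (v k : ℝ) * h5

theorem sqrt_two_mul_sub_six_lt_betaSeq (u : ℕ → ℤ) (k : ℕ) :
    Real.sqrt (2 * (u k : ℝ)) - 6 < betaSeq u k := by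
  have h5 : Real.sqrt 5 < 5 / 2 := by
    rw [Real.sqrt_lt' (by norm_num)]; norm_num
  have h5pos : 0 < Real.sqrt 5 := by positivity
  have hsqrt : 2 * (Real.sqrt 5 * Real.sqrt ((u k : ℝ) / 10)) = Real.sqrt (2 * (u k : ℝ)) := by
    have h4 : Real.sqrt 4 = 2 := by
      rw [show (4 : ℝ) = 2 ^ 2 by norm_num, Real.sqrt_sq (by norm_num)]
    rw [← Real.sqrt_mul (by norm_num), ← h4, ← Real.sqrt_mul (by norm_num)]
    congr 1
    ring
  have hy : Real.sqrt ((u k : ℝ) / 10) - 1 < ySeq u k := Int.sub_one_lt_floor _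
  have hb : Real.sqrt 5 * ySeq u k - 1 < (⌊Real.sqrt 5 * ySeq u k⌋ : ℝ) :=
    Int.sub_one_lt_floor _
  have hmul := mul_lt_mul_of_pos_left hy h5pos
  unfold betaSeq
  linarith

/-- For all sufficiently large `k`, `β_k² > (6 + √5)^k`. -/
theorem beta_sq_eventually_gt (u v : ℕ → ℤ)
    (huv : ∀ k, ((6 : ℝ) + Real.sqrt 5) ^ k = (u k : ℝ) + (v k : ℝ) * Real.sqrt 5) :
    ∀ᶠ k in atTop, ((6 : ℝ) + Real.sqrt 5) ^ k < betaSeq u k ^ 2 := by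
  have h5 : Real.sqrt 5 < 23 / 10 := by
    rw [Real.sqrt_lt' (by norm_num)]; norm_num
  have h5pos : 0 < Real.sqrt 5 := by positivity
  have hgrowth : ∀ᶠ k : ℕ in atTop, (18 : ℝ) < (37 / 29 : ℝ) ^ k :=
    (tendsto_pow_atTop_atTop_of_one_lt (by norm_num)).eventually_gt_atTop 18
  filter_upwards [hgrowth] with k hk
  have hsum : 2 * (u k : ℝ) = (6 + Real.sqrt 5) ^ k + (6 - Real.sqrt 5) ^ k := by
    rw [huv k, six_sub_sqrt_five_pow huv k]; ring
  have hρ : (6 + Real.sqrt 5) ^ k ≤ ((29 / 10 : ℝ) ^ k) ^ 2 := by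
    rw [← pow_mul, mul_comm k 2, pow_mul]
    exact pow_le_pow_left₀ (by positivity) (by norm_num; linarith) k
  have hσ : (37 / 10 : ℝ) ^ k ≤ (6 - Real.sqrt 5) ^ k :=
    pow_le_pow_left₀ (by norm_num) (by linarith) k
  have hσρ : (6 - Real.sqrt 5) ^ k ≤ (6 + Real.sqrt 5) ^ k :=
    pow_le_pow_left₀ (by linarith) (by linarith) k
  have hR : (0 : ℝ) < (29 / 10 : ℝ) ^ k := by positivity
  have hcmp : 18 * (29 / 10 : ℝ) ^ k < (37 / 10 : ℝ) ^ k := by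
    rw [show (37 / 10 : ℝ) = 37 / 29 * (29 / 10) by norm_num, mul_pow]
    exact mul_lt_mul_of_pos_right hk hR
  have hρpos : 0 < (6 + Real.sqrt 5) ^ k := by positivity
  have hM := Real.sq_sqrt (show 0 ≤ 2 * (u k : ℝ) by linarith)
  have hβ := sqrt_two_mul_sub_six_lt_betaSeq u k
  have hM0 := Real.sqrt_nonneg (2 * (u k : ℝ))
  set M := Real.sqrt (2 * (u k : ℝ))
  have hMle : M ≤ 3 / 2 * (29 / 10 : ℝ) ^ k := by
    refine le_of_abs_le (abs_le_of_sq_le_sq ?_ (by positivity))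
    nlinarith
  have hsq : (6 + Real.sqrt 5) ^ k < (M - 6) ^ 2 := by nlinarith
  have hM6 : 0 ≤ M - 6 := by
    nlinarith
  exact hsq.trans (pow_lt_pow_left₀ hβ hM6 two_ne_zero)
end
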